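/- For a finite MDP with discount factor γ ∈ [0,1), let v* be the unique fixed point of the Bellman optimality operator and define q*(s,a) = R(s,a) + γ ∑_{s'} P(s,a)(s')·v*(s'). Then there exists an optimal deterministic policy obtained by maximizing the optimal action-value function: for any choice function a* : S → A with q*(s, a*(s)) = max_{a∈A} q*(s,a) for all s, the deterministic policy π* that puts all probability mass on a*(s) in state s satisfies T_{π*} v* = v*, and hence its state-value function equals v*: v_{π*}(s) = v*(s) for all s ∈ S. -/

import Mathlib

theorem PMF.sum_toReal_eq_one {α : Type*} [Fintype α] (p : PMF α) :
    ∑ a, (p a).toReal = 1 := by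
  rw [← ENNReal.toReal_sum fun a _ => p.apply_ne_top a, ← tsum_fintype (L := .unconditional α),
    p.tsum_coe, ENNReal.toReal_one]

theorem PMF.sum_pure_toReal_mul {α : Type*} [Fintype α] (b : α) (f : α → ℝ) :
    ∑ a, (PMF.pure b a).toReal * f a = f b := by
  classical
  rw [Finset.sum_eq_single b] <;> simp +contextual [PMF.pure_apply]

/-- A function on a finite set that equals its own discounted expectation vanishes. -/
theorem eq_zero_of_eq_discounted_expectation {S : Type*} [Fintype S] (p : S → PMF S)
    {γ : ℝ} (hγ0 : 0 ≤ γ) (hγ1 : γ < 1) {d : S → ℝ}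
    (hd : ∀ s, d s = γ * ∑ s', (p s s').toReal * d s') (s : S) : d s = 0 := by
  have : Nonempty S := ⟨s⟩
  obtain ⟨m, hm⟩ := Finite.exists_max fun s => |d s|
  have hsum : |∑ s', (p m s').toReal * d s'| ≤ |d m| :=
    calc |∑ s', (p m s').toReal * d s'|
        ≤ ∑ s', |(p m s').toReal * d s'| := Finset.abs_sum_le_sum_abs _ _
      _ ≤ ∑ s', (p m s').toReal * |d m| := by
          refine Finset.sum_le_sum fun s' _ => ?_
          rw [abs_mul, abs_of_nonneg ENNReal.toReal_nonneg]
          exact mul_le_mul_of_nonneg_left (hm s') ENNReal.toReal_nonneg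
      _ = |d m| := by rw [← Finset.sum_mul, PMF.sum_toReal_eq_one, one_mul]
  have hle : |d m| ≤ γ * |d m| := by
    conv_lhs => rw [hd m, abs_mul, abs_of_nonneg hγ0]
    exact mul_le_mul_of_nonneg_left hsum hγ0
  have hm0 : |d m| ≤ 0 := by nlinarith [abs_nonneg (d m)]
  exact abs_nonpos_iff.mp ((hm s).trans hm0)

/-- Let `v*` be the unique fixed point of the Bellman optimality operator and
`q* (s,a) = R s a + γ * ∑ s', P s a s' * v* s'`. For any choice function `a* : S → A` with
`q* (s, a* s) = max_a q* s a`, the deterministic policy `π* s = pure (a* s)` satisfies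
`T_{π*} v* = v*`, and its state-value function (the unique fixed point of `T_{π*}`)
equals `v*`. -/
theorem optimal_deterministic_policy
    {S A : Type*} [Fintype S] [Fintype A] [Nonempty S] [Nonempty A]
    (P : S → A → PMF S) (R : S → A → ℝ)
    (γ : ℝ) (hγ0 : 0 ≤ γ) (hγ1 : γ < 1)
    (vstar : S → ℝ)
    (hvstar : ∀ s, vstar s =
      Finset.univ.sup' Finset.univ_nonempty
        (fun a : A => R s a + γ * ∑ s', ((P s a) s').toReal * vstar s'))
    (q : S → A → ℝ)
    (hq : ∀ s a, q s a = R s a + γ * ∑ s', ((P s a) s').toReal * vstar s')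
    (astar : S → A)
    (hastar : ∀ s, q s (astar s) =
      Finset.univ.sup' Finset.univ_nonempty (fun a : A => q s a))
    (πstar : S → PMF A) (hπstar : ∀ s, πstar s = PMF.pure (astar s))
    (vπ : S → ℝ)
    (hvπ : ∀ s, vπ s =
      ∑ a, ((πstar s) a).toReal *
        (R s a + γ * ∑ s', ((P s a) s').toReal * vπ s')) :
    (∀ s, (∑ a, ((πstar s) a).toReal *
        (R s a + γ * ∑ s', ((P s a) s').toReal * vstar s')) = vstar s) ∧
      (∀ s, vπ s = vstar s) := by
  simp only [hπstar, PMF.sum_pure_toReal_mul] at hvπ ⊢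
  have hfix : ∀ s, R s (astar s) + γ * ∑ s', (P s (astar s) s').toReal * vstar s' = vstar s := by
    intro s
    rw [← hq, hastar, hvstar]
    simp only [hq]
  refine ⟨hfix, fun s => sub_eq_zero.mp ?_⟩
  refine eq_zero_of_eq_discounted_expectation (fun s => P s (astar s)) hγ0 hγ1
    (d := fun s => vπ s - vstar s) (fun s => ?_) s
  simp only [mul_sub, Finset.sum_sub_distrib]
  linarith [hvπ s, hfix s]
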